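/- arXiv:2509.10142 — 6 statements merged into one kernel-verified Lean document; each statement's English description precedes it below -/
import Mathlib

section
/- Let u : ℝ³ → ℝ be three times continuously differentiable and fix a point (x₀,y₀,z₀) ∈ ℝ³. Then there exist constants C > 0 and h₀ ∈ (0,1] such that for all step sizes hx, hy, hz with 0 < hx,hy,hz ≤ h₀, the discrete first derivative along Z, Dz u := (1/(4hz)) ∑_{m∈{0,1}} ∑_{n∈{0,1}} ( u(x₀+m·hx, y₀+n·hy, z₀+hz) − u(x₀+m·hx, y₀+n·hy, z₀) ), satisfies | Dz u − ∂u/∂z (x₀+hx/2, y₀+hy/2, z₀+hz/2) | ≤ C · (max(hx,hy,hz))². -/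
/-- The symmetric second difference of a `C²` function is locally bounded by a multiple of
the square of the norm of the increment. -/
theorem ContDiff.exists_abs_add_sub_two_mul_le {E : Type*} [NormedAddCommGroup E]
    [NormedSpace ℝ E] {g : E → ℝ} (hg : ContDiff ℝ 2 g) (p : E) :
    ∃ K : ℝ, 0 < K ∧ ∃ δ : ℝ, 0 < δ ∧ ∀ c w : E, ‖c - p‖ + ‖w‖ < δ →
      |g (c + w) + g (c - w) - 2 * g c| ≤ K * ‖w‖ ^ 2 := by
  have hg' : ContDiff ℝ 1 (fderiv ℝ g) := hg.fderiv_right (by norm_num)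
  obtain ⟨K, s, hs, hK⟩ := hg'.contDiffAt (x := p) |>.exists_lipschitzOnWith
  obtain ⟨δ, hδ, hball⟩ := Metric.mem_nhds_iff.1 hs
  refine ⟨2 * K + 1, by positivity, δ, hδ, fun c w hcw => ?_⟩
  have hd : Differentiable ℝ g := hg.differentiable (by norm_num)
  have hr : ∀ t : ℝ, HasDerivAt (fun t : ℝ => g (c + t • w) + g (c - t • w))
      (fderiv ℝ g (c + t • w) w - fderiv ℝ g (c - t • w) w) t := by
    intro t
    have hline : HasDerivAt (fun t : ℝ => t • w) w t := by
      simpa using (hasDerivAt_id t).smul_const w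
    have h₁ := (hd (c + t • w)).hasFDerivAt.comp_hasDerivAt t (hline.const_add c)
    have h₂ := (hd (c - t • w)).hasFDerivAt.comp_hasDerivAt t (hline.const_sub c)
    rw [map_neg] at h₂
    rw [sub_eq_add_neg]
    exact h₁.add h₂
  obtain ⟨t, ⟨ht₀, ht₁⟩, ht⟩ := exists_hasDerivAt_eq_slope _ _ one_pos
    (fun t _ => (hr t).continuousAt.continuousWithinAt) (fun t _ => hr t)
  have htw : ‖t • w‖ ≤ ‖w‖ := by
    rw [norm_smul, Real.norm_of_nonneg ht₀.le]
    exact mul_le_of_le_one_left (norm_nonneg w) ht₁.le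
  have hadd : c + t • w ∈ s := hball <| by
    rw [mem_ball_iff_norm, add_sub_right_comm]
    exact (norm_add_le _ _).trans_lt (by linarith)
  have hsub : c - t • w ∈ s := hball <| by
    rw [mem_ball_iff_norm, sub_right_comm]
    exact (norm_sub_le _ _).trans_lt (by linarith)
  have hdiff : ‖fderiv ℝ g (c + t • w) - fderiv ℝ g (c - t • w)‖ ≤ K * (2 * ‖w‖) := by
    refine (hK.norm_sub_le hadd hsub).trans ?_
    gcongr
    rw [add_sub_sub_cancel]
    exact (norm_add_le _ _).trans (by linarith)
  have heq : g (c + w) + g (c - w) - 2 * g c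
      = (fderiv ℝ g (c + t • w) - fderiv ℝ g (c - t • w)) w := by
    rw [sub_apply, ht]
    simp
    ring
  rw [heq, ← Real.norm_eq_abs]
  refine (ContinuousLinearMap.le_of_opNorm_le _ hdiff w).trans ?_
  nlinarith [sq_nonneg ‖w‖]

/-- Second-order consistency of the discrete first derivative along Z
for a `C³` function `u : ℝ³ → ℝ`, at the cell with lowest vertex `(x₀, y₀, z₀)`. -/
theorem discrete_first_derivative_Z_consistency
    (u : ℝ × ℝ × ℝ → ℝ) (hu : ContDiff ℝ 3 u) (x₀ y₀ z₀ : ℝ) :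
    ∃ C : ℝ, 0 < C ∧ ∃ h₀ : ℝ, 0 < h₀ ∧ h₀ ≤ 1 ∧
      ∀ hx hy hz : ℝ, 0 < hx → 0 < hy → 0 < hz → hx ≤ h₀ → hy ≤ h₀ → hz ≤ h₀ →
        |(1 / (4 * hz)) *
            (∑ m ∈ Finset.range 2, ∑ n ∈ Finset.range 2,
              (u (x₀ + (m : ℝ) * hx, y₀ + (n : ℝ) * hy, z₀ + hz)
                - u (x₀ + (m : ℝ) * hx, y₀ + (n : ℝ) * hy, z₀)))
          - deriv (fun t => u (x₀ + hx / 2, y₀ + hy / 2, t)) (z₀ + hz / 2)|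
          ≤ C * (max (max hx hy) hz) ^ 2 := by
  set g : ℝ × ℝ × ℝ → ℝ := fun p => fderiv ℝ u p (0, 0, 1)
  have hg : ContDiff ℝ 2 g := (hu.fderiv_right (by norm_num)).clm_apply contDiff_const
  have hderiv : ∀ x y z : ℝ, HasDerivAt (fun t => u (x, y, t)) (g (x, y, z)) z := fun x y z =>
    ((hu.differentiable (by norm_num)) (x, y, z)).hasFDerivAt.comp_hasDerivAt z
      ((hasDerivAt_const z x).prodMk ((hasDerivAt_const z y).prodMk (hasDerivAt_id z)))
  obtain ⟨K, hK, δ, hδ, hsymm⟩ := hg.exists_abs_add_sub_two_mul_le (x₀, y₀, z₀)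
  refine ⟨K, hK, min 1 (δ / 2), by positivity, min_le_left _ _, ?_⟩
  intro hx hy hz hx0 hy0 hz0 hxh hyh hzh
  set H := max (max hx hy) hz
  have hxH : hx ≤ H := (le_max_left _ _).trans (le_max_left _ _)
  have hyH : hy ≤ H := (le_max_right _ _).trans (le_max_left _ _)
  have hzH : hz ≤ H := le_max_right _ _
  have hHδ : H ≤ δ / 2 := (max_le (max_le hxh hyh) hzh).trans (min_le_right _ _)
  rw [(hderiv (x₀ + hx / 2) (y₀ + hy / 2) (z₀ + hz / 2)).deriv]
  -- The mean value theorem is applied to the odd part in `z` about the center, which makes the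
  -- evaluation points of the derivative symmetric about the center of the cell.
  have hodd : ∀ x y t : ℝ, HasDerivAt
      (fun t => u (x, y, z₀ + hz / 2 + t) - u (x, y, z₀ + hz / 2 - t))
      (g (x, y, z₀ + hz / 2 + t) + g (x, y, z₀ + hz / 2 - t)) t := by
    intro x y t
    have h₁ := (hderiv x y (z₀ + hz / 2 + t)).comp_const_add (z₀ + hz / 2) t
    have h₂ := (hderiv x y (z₀ + hz / 2 - t)).comp_const_sub (z₀ + hz / 2) t
    exact (h₁.sub h₂).congr_deriv (sub_neg_eq_add _ _)
  have hsum := fun t : ℝ => ((hodd x₀ y₀ t).add (hodd x₀ (y₀ + hy) t)).add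
    ((hodd (x₀ + hx) y₀ t).add (hodd (x₀ + hx) (y₀ + hy) t))
  obtain ⟨t, ⟨ht₀, ht₁⟩, ht⟩ := exists_hasDerivAt_eq_slope _ _ (half_pos hz0)
    (fun t _ => (hsum t).continuousAt.continuousWithinAt) (fun t _ => hsum t)
  have hbound : ∀ a b : ℝ, |a| ≤ H / 2 → |b| ≤ H / 2 →
      |g (x₀ + hx / 2 + a, y₀ + hy / 2 + b, z₀ + hz / 2 + t)
        + g (x₀ + hx / 2 - a, y₀ + hy / 2 - b, z₀ + hz / 2 - t)
        - 2 * g (x₀ + hx / 2, y₀ + hy / 2, z₀ + hz / 2)| ≤ K * (H / 2) ^ 2 := by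
    intro a b ha hb
    have hw : ‖(a, b, t)‖ ≤ H / 2 := by
      simp only [norm_prod_le_iff, Real.norm_eq_abs, abs_of_pos ht₀]
      exact ⟨ha, hb, by linarith⟩
    have hc : ‖(x₀ + hx / 2, y₀ + hy / 2, z₀ + hz / 2) - (x₀, y₀, z₀)‖ ≤ H / 2 := by
      simp only [Prod.mk_sub_mk, add_sub_cancel_left, norm_prod_le_iff, Real.norm_eq_abs,
        abs_of_pos (half_pos hx0), abs_of_pos (half_pos hy0), abs_of_pos (half_pos hz0)]
      exact ⟨by linarith, by linarith, by linarith⟩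
    refine (hsymm (x₀ + hx / 2, y₀ + hy / 2, z₀ + hz / 2) (a, b, t) (by linarith)).trans ?_
    gcongr
  have hax : |hx / 2| ≤ H / 2 := by rw [abs_of_pos (half_pos hx0)]; linarith
  have hay : |hy / 2| ≤ H / 2 := by rw [abs_of_pos (half_pos hy0)]; linarith
  have hax' : |-(hx / 2)| ≤ H / 2 := by rwa [abs_neg]
  have hay' : |-(hy / 2)| ≤ H / 2 := by rwa [abs_neg]
  have b₁ := hbound _ _ hax hay
  have b₂ := hbound _ _ hax hay'
  have b₃ := hbound _ _ hax' hay
  have b₄ := hbound _ _ hax' hay'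
  simp only [← sub_eq_add_neg, sub_neg_eq_add, add_sub_cancel_right, add_assoc, add_halves]
    at b₁ b₂ b₃ b₄
  simp only [Pi.add_apply, add_assoc, add_halves, add_sub_cancel_right, sub_zero, add_zero,
    sub_self] at ht
  rw [eq_div_iff (half_pos hz0).ne'] at ht
  simp only [Finset.sum_range_succ, Finset.sum_range_zero, Nat.cast_zero, Nat.cast_one, zero_mul,
    one_mul, add_zero, zero_add, add_assoc]
  have hscale : ∀ S : ℝ, 1 / (4 * hz) * (S * (hz / 2)) = S / 8 := by
    intro S
    field_simp
    ring
  rw [← ht, hscale]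
  have hKH : 0 ≤ K * H ^ 2 := by positivity
  rw [abs_le] at b₁ b₂ b₃ b₄ ⊢
  constructor <;> linarith
end

section
/- Let u : ℝ³ → ℝ be four times continuously differentiable and fix a point (x₀,y₀,z₀) ∈ ℝ³. Then there exist constants C > 0 and h₀ ∈ (0,1] such that for all step sizes hx, hy, hz with 0 < hx,hy,hz ≤ h₀, the discrete second derivative along X, Dxx u := (1/(8hx²)) ∑_{m=0}^{3} η_m ∑_{n∈{0,1}} ∑_{p∈{0,1}} u(x₀+(m−1)·hx, y₀+n·hy, z₀+p·hz), with weights η₀ = η₃ = 1 and η₁ = η₂ = −1, satisfies | Dxx u − ∂²u/∂x² (x₀+hx/2, y₀+hy/2, z₀+hz/2) | ≤ C · (max(hx,hy,hz))². -/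
/-- The stencil weights `η₀ = η₃ = 1`, `η₁ = η₂ = -1`. -/
def etaCoeff : ℕ → ℝ := fun m => if m = 0 ∨ m = 3 then 1 else -1

/-- A partial map in the first variable is differentiable, with derivative the directional
derivative along `(1, 0, 0)`. -/
theorem hasDerivAt_fst_slice {v : ℝ × ℝ × ℝ → ℝ} (hv : Differentiable ℝ v) (x y z : ℝ) :
    HasDerivAt (fun t => v (t, y, z)) (fderiv ℝ v (x, y, z) (1, 0, 0)) x :=
  (hv (x, y, z)).hasFDerivAt.comp_hasDerivAt x
    ((hasDerivAt_id x).prodMk ((hasDerivAt_const x y).prodMk (hasDerivAt_const x z)))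

/-- A mean value theorem for the four-point second difference with weights `1, -1, -1, 1`. -/
theorem exists_four_point_difference_eq {g g₁ g₂ : ℝ → ℝ}
    (hg : ∀ x, HasDerivAt g (g₁ x) x) (hg₁ : ∀ x, HasDerivAt g₁ (g₂ x) x)
    (c : ℝ) {h : ℝ} (hh : 0 < h) :
    ∃ r, 0 < r ∧ r < 3 * h / 2 ∧
      g (c - 3 * h / 2) - g (c - h / 2) - g (c + h / 2) + g (c + 3 * h / 2) =
        h ^ 2 * (g₂ (c + r) + g₂ (c - r)) := by
  have hφ (t : ℝ) :
      HasDerivAt (fun t => g (c + t) + g (c - t)) (g₁ (c + t) - g₁ (c - t)) t := by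
    rw [sub_eq_add_neg]
    exact ((hg (c + t)).comp_const_add c t).add ((hg (c - t)).comp_const_sub c t)
  have hφ₁ (t : ℝ) :
      HasDerivAt (fun t => g₁ (c + t) - g₁ (c - t)) (g₂ (c + t) + g₂ (c - t)) t := by
    rw [← sub_neg_eq_add]
    exact ((hg₁ (c + t)).comp_const_add c t).sub ((hg₁ (c - t)).comp_const_sub c t)
  have hsq (t : ℝ) : HasDerivAt (fun t : ℝ => t ^ 2) (2 * t) t := by
    simpa using hasDerivAt_pow 2 t
  obtain ⟨s, ⟨hs₁, hs₂⟩, hs⟩ := exists_ratio_hasDerivAt_eq_ratio_slope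
    _ _ (show h / 2 < 3 * h / 2 by linarith)
    (fun t _ => (hφ t).continuousAt.continuousWithinAt) (fun t _ => hφ t)
    _ _ (fun t _ => (hsq t).continuousAt.continuousWithinAt) (fun t _ => hsq t)
  have hs₀ : 0 < s := by linarith
  obtain ⟨r, ⟨hr₁, hr₂⟩, hr⟩ := exists_hasDerivAt_eq_slope _ _ hs₀
    (fun t _ => (hφ₁ t).continuousAt.continuousWithinAt) (fun t _ => hφ₁ t)
  refine ⟨r, hr₁, hr₂.trans hs₂, ?_⟩
  rw [eq_div_iff (by linarith)] at hr
  simp only [add_zero, sub_zero, sub_self] at hr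
  rw [← hr] at hs
  refine mul_right_cancel₀ hs₀.ne' ?_
  linear_combination -hs / 2

/-- The symmetric second difference of a `C²` function is locally uniformly quadratic. -/
theorem ContDiff.exists_norm_symm_second_difference_le {E : Type*} [NormedAddCommGroup E]
    [NormedSpace ℝ E] [ProperSpace E] {w : E → ℝ} (hw : ContDiff ℝ 2 w) (a : E) (R : ℝ) :
    ∃ K, 0 < K ∧ ∀ c d : E, c ∈ Metric.closedBall a R → c + d ∈ Metric.closedBall a R →
      c - d ∈ Metric.closedBall a R → |w (c + d) + w (c - d) - 2 * w c| ≤ K * ‖d‖ ^ 2 := by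
  have hw₁ : ContDiff ℝ 1 (fderiv ℝ w) := hw.fderiv_right (by norm_num)
  obtain ⟨K, hK⟩ := (isCompact_closedBall a R).exists_bound_of_continuousOn
    (hw₁.continuous_fderiv (by norm_num)).continuousOn
  have hK₀ : 0 < |K| + 1 := by positivity
  have taylor (c d : E) (hc : c ∈ Metric.closedBall a R) (hd : c + d ∈ Metric.closedBall a R) :
      |w (c + d) - w c - fderiv ℝ w c d| ≤ (|K| + 1) * ‖d‖ ^ 2 := by
    have hseg := (convex_closedBall a R).segment_subset hc hd
    have key := (convex_segment (𝕜 := ℝ) c (c + d)).norm_image_sub_le_of_norm_fderiv_le'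
      (f := w) (φ := fderiv ℝ w c) (C := (|K| + 1) * ‖d‖)
      (fun x _ => hw.differentiable (by norm_num) x) (fun x hx => ?_)
      (left_mem_segment ℝ c (c + d)) (right_mem_segment ℝ c (c + d))
    · simpa [pow_two, mul_assoc] using key
    · have hlip := (convex_closedBall a R).norm_image_sub_le_of_norm_fderiv_le
        (f := fderiv ℝ w) (C := |K| + 1)
        (fun x _ => hw₁.differentiable (by norm_num) x)
        (fun x hx => (hK x hx).trans ((le_abs_self K).trans (by linarith))) hc (hseg hx)
      have hdist : ‖x - c‖ ≤ ‖d‖ := by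
        simpa using norm_sub_le_of_mem_segment hx
      exact hlip.trans (by gcongr)
  refine ⟨2 * (|K| + 1), by positivity, fun c d hc hp hm => ?_⟩
  have h₁ := abs_le.1 (taylor c d hc hp)
  have h₂ := taylor c (-d) hc (by rwa [← sub_eq_add_neg])
  rw [← sub_eq_add_neg, map_neg, norm_neg] at h₂
  have h₃ := abs_le.1 h₂
  rw [abs_le]
  constructor <;> linarith [h₁.1, h₁.2, h₃.1, h₃.2]

/-- Second-order consistency of the discrete second derivative along X
for a `C⁴` function `u : ℝ³ → ℝ`, at the cell with lowest vertex `(x₀, y₀, z₀)`. -/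
theorem discrete_second_derivative_X_consistency
    (u : ℝ × ℝ × ℝ → ℝ) (hu : ContDiff ℝ 4 u) (x₀ y₀ z₀ : ℝ) :
    ∃ C : ℝ, 0 < C ∧ ∃ h₀ : ℝ, 0 < h₀ ∧ h₀ ≤ 1 ∧
      ∀ hx hy hz : ℝ, 0 < hx → 0 < hy → 0 < hz → hx ≤ h₀ → hy ≤ h₀ → hz ≤ h₀ →
        |(1 / (8 * hx ^ 2)) *
            (∑ m ∈ Finset.range 4, etaCoeff m *
              ∑ n ∈ Finset.range 2, ∑ p ∈ Finset.range 2,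
                u (x₀ + ((m : ℝ) - 1) * hx, y₀ + (n : ℝ) * hy, z₀ + (p : ℝ) * hz))
          - deriv (deriv (fun t => u (t, y₀ + hy / 2, z₀ + hz / 2))) (x₀ + hx / 2)|
          ≤ C * (max (max hx hy) hz) ^ 2 := by
  have hu₁ : ContDiff ℝ 3 (fun q => fderiv ℝ u q (1, 0, 0)) :=
    (hu.fderiv_right (by norm_num)).clm_apply contDiff_const
  set v : ℝ × ℝ × ℝ → ℝ := fun q => fderiv ℝ u q (1, 0, 0)
  have hv₁ : ContDiff ℝ 2 (fun q => fderiv ℝ v q (1, 0, 0)) :=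
    (hu₁.fderiv_right (by norm_num)).clm_apply contDiff_const
  set w : ℝ × ℝ × ℝ → ℝ := fun q => fderiv ℝ v q (1, 0, 0)
  have du (x y z : ℝ) : HasDerivAt (fun t => u (t, y, z)) (v (x, y, z)) x :=
    hasDerivAt_fst_slice (hu.differentiable (by norm_num)) x y z
  have dv (x y z : ℝ) : HasDerivAt (fun t => v (t, y, z)) (w (x, y, z)) x :=
    hasDerivAt_fst_slice (hu₁.differentiable (by norm_num)) x y z
  obtain ⟨K, hK₀, hK⟩ := hv₁.exists_norm_symm_second_difference_le (x₀, y₀, z₀) 2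
  refine ⟨9 / 8 * K, by positivity, 1, one_pos, le_rfl, ?_⟩
  intro hx hy hz hx₀ hy₀ hz₀ hx₁ hy₁ hz₁
  have hdd : deriv (deriv (fun t => u (t, y₀ + hy / 2, z₀ + hz / 2))) (x₀ + hx / 2) =
      w (x₀ + hx / 2, y₀ + hy / 2, z₀ + hz / 2) := by
    rw [show deriv (fun t => u (t, y₀ + hy / 2, z₀ + hz / 2)) =
      fun t => v (t, y₀ + hy / 2, z₀ + hz / 2) from funext fun t => (du t _ _).deriv]
    exact (dv _ _ _).deriv
  obtain ⟨r, hr₀, hr₁, hr⟩ := exists_four_point_difference_eq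
    (fun x => (((du x y₀ z₀).add (du x y₀ (z₀ + hz))).add (du x (y₀ + hy) z₀)).add
      (du x (y₀ + hy) (z₀ + hz)))
    (fun x => (((dv x y₀ z₀).add (dv x y₀ (z₀ + hz))).add (dv x (y₀ + hy) z₀)).add
      (dv x (y₀ + hy) (z₀ + hz)))
    (x₀ + hx / 2) hx₀
  set H := max (max hx hy) hz
  have hxH : hx ≤ H := (le_max_left _ _).trans (le_max_left _ _)
  have hyH : hy ≤ H := (le_max_right _ _).trans (le_max_left _ _)
  have hzH : hz ≤ H := le_max_right _ _
  have pair (b c : ℝ) (hb : |b| = hy / 2) (hc : |c| = hz / 2) :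
      |w (x₀ + hx / 2 + r, y₀ + hy / 2 + b, z₀ + hz / 2 + c)
        + w (x₀ + hx / 2 - r, y₀ + hy / 2 - b, z₀ + hz / 2 - c)
        - 2 * w (x₀ + hx / 2, y₀ + hy / 2, z₀ + hz / 2)| ≤ K * (3 / 2 * H) ^ 2 := by
    have hb₁ := abs_le.1 hb.le
    have hc₁ := abs_le.1 hc.le
    refine (hK (x₀ + hx / 2, y₀ + hy / 2, z₀ + hz / 2) (r, b, c) ?_ ?_ ?_).trans ?_
    iterate 3
      simp only [Prod.mk_add_mk, Prod.mk_sub_mk, Metric.mem_closedBall, Prod.dist_eq,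
        Real.dist_eq, max_le_iff, abs_le]
      refine ⟨⟨?_, ?_⟩, ⟨?_, ?_⟩, ?_, ?_⟩ <;> linarith [hb₁.1, hb₁.2, hc₁.1, hc₁.2]
    · have hnorm : ‖((r, b, c) : ℝ × ℝ × ℝ)‖ ≤ 3 / 2 * H := by
        simp only [Prod.norm_mk, Real.norm_eq_abs, max_le_iff, hb, hc, abs_of_pos hr₀]
        refine ⟨?_, ?_, ?_⟩ <;> linarith
      gcongr
  have habs {h : ℝ} (h₀ : 0 < h) : |h / 2| = h / 2 := abs_of_pos (by linarith)
  have habs' {h : ℝ} (h₀ : 0 < h) : |-(h / 2)| = h / 2 := by rw [abs_neg, habs h₀]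
  have p₁ := abs_le.1 (pair _ _ (habs hy₀) (habs hz₀))
  have p₂ := abs_le.1 (pair _ _ (habs hy₀) (habs' hz₀))
  have p₃ := abs_le.1 (pair _ _ (habs' hy₀) (habs hz₀))
  have p₄ := abs_le.1 (pair _ _ (habs' hy₀) (habs' hz₀))
  have half (a h : ℝ) : a + h / 2 + h / 2 = a + h := by ring
  simp only [← sub_eq_add_neg, sub_neg_eq_add, add_sub_cancel_right, half] at p₁ p₂ p₃ p₄
  have e₀ : x₀ + hx / 2 - 3 * hx / 2 = x₀ - hx := by ring
  have e₃ : x₀ + hx / 2 + 3 * hx / 2 = x₀ + 2 * hx := by ring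
  simp only [Pi.add_apply, e₀, e₃, add_sub_cancel_right, half] at hr
  have f₀ : x₀ + (0 - 1) * hx = x₀ - hx := by ring
  have f₃ : x₀ + (3 - 1) * hx = x₀ + 2 * hx := by ring
  have f₂ : x₀ + (2 - 1) * hx = x₀ + hx := by ring
  rw [hdd]
  simp only [Finset.sum_range_succ, Finset.sum_range_zero, etaCoeff, Nat.cast_zero, Nat.cast_one,
    Nat.cast_ofNat, zero_mul, one_mul, add_zero, zero_add, sub_self, f₀, f₂, f₃]
  norm_num only [if_true, if_false, or_true, true_or, or_self]
  generalize w (x₀ + hx / 2, y₀ + hy / 2, z₀ + hz / 2) = W at *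
  have hk : 1 / (8 * hx ^ 2) * hx ^ 2 = 1 / 8 := by field_simp
  have hr' := congrArg (1 / (8 * hx ^ 2) * ·) hr
  simp only [← mul_assoc, hk] at hr'
  generalize 1 / (8 * hx ^ 2) = k at *
  rw [abs_le]
  constructor <;> linarith [p₁.1, p₁.2, p₂.1, p₂.2, p₃.1, p₃.2, p₄.1, p₄.2]
end

section
/- Let u : ℝ³ → ℝ be four times continuously differentiable and fix a point (x₀,y₀,z₀) ∈ ℝ³. Then there exist constants C > 0 and h₀ ∈ (0,1] such that for all step sizes hx, hy, hz with 0 < hx,hy,hz ≤ h₀, the discrete second derivative along Y, Dyy u := (1/(8hy²)) ∑_{m=0}^{3} η_m ∑_{n∈{0,1}} ∑_{p∈{0,1}} u(x₀+n·hx, y₀+(m−1)·hy, z₀+p·hz), with weights η₀ = η₃ = 1 and η₁ = η₂ = −1, satisfies | Dyy u − ∂²u/∂y² (x₀+hx/2, y₀+hy/2, z₀+hz/2) | ≤ C · (max(hx,hy,hz))². -/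
/-- A symmetric second difference is quadratically small where the derivative is Lipschitz. -/
theorem abs_add_sub_two_mul_le_of_lipschitzOnWith_fderiv
    {E : Type*} [NormedAddCommGroup E] [NormedSpace ℝ E] {w : E → ℝ} (hw : Differentiable ℝ w)
    {K : NNReal} {s : Set E} (hs : Convex ℝ s) (hK : LipschitzOnWith K (fderiv ℝ w) s)
    {c d : E} (h₁ : c + d ∈ s) (h₂ : c - d ∈ s) :
    |w (c + d) + w (c - d) - 2 * w c| ≤ 2 * K * ‖d‖ ^ 2 := by
  have hderiv : ∀ t : ℝ, HasDerivAt (fun t : ℝ => w (c + t • d) + w (c + (-t) • d))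
      ((fderiv ℝ w (c + t • d) - fderiv ℝ w (c + (-t) • d)) d) t := by
    intro t
    have e₁ : HasDerivAt (fun t : ℝ => c + t • d) d t := by
      simpa using ((hasDerivAt_id t).smul_const d).const_add c
    have e₂ : HasDerivAt (fun t : ℝ => c + (-t) • d) (-d) t := by
      simpa using ((hasDerivAt_id t).neg.smul_const d).const_add c
    have := ((hw _).hasFDerivAt.comp_hasDerivAt t e₁).add
      ((hw _).hasFDerivAt.comp_hasDerivAt t e₂)
    refine this.congr_deriv ?_
    simp [sub_eq_add_neg]
  have hmem : ∀ t ∈ Set.Icc (-1 : ℝ) 1, c + t • d ∈ s := by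
    intro t ht
    have := hs h₁ h₂ (a := (1 + t) / 2) (b := (1 - t) / 2) (by linarith [ht.1])
      (by linarith [ht.2]) (by ring)
    convert this using 1
    module
  have hbound : ∀ t ∈ Set.Icc (0 : ℝ) 1,
      ‖(fderiv ℝ w (c + t • d) - fderiv ℝ w (c + (-t) • d)) d‖ ≤ 2 * K * ‖d‖ ^ 2 := by
    intro t ht
    have hL := hK.norm_sub_le (hmem t ⟨by linarith [ht.1], ht.2⟩)
      (hmem (-t) ⟨by linarith [ht.2], by linarith [ht.1]⟩)
    have hdist : ‖c + t • d - (c + (-t) • d)‖ ≤ 2 * ‖d‖ := by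
      have : c + t • d - (c + (-t) • d) = (2 * t) • d := by module
      rw [this, norm_smul, Real.norm_eq_abs, abs_of_nonneg (by linarith [ht.1])]
      gcongr
      linarith [ht.2]
    calc _ ≤ ‖fderiv ℝ w (c + t • d) - fderiv ℝ w (c + (-t) • d)‖ * ‖d‖ :=
          ContinuousLinearMap.le_opNorm _ _
      _ ≤ (K * (2 * ‖d‖)) * ‖d‖ := by gcongr; exact hL.trans (by gcongr)
      _ = _ := by ring
  have := (convex_Icc (0 : ℝ) 1).norm_image_sub_le_of_norm_hasDerivWithin_le
    (fun t _ => (hderiv t).hasDerivWithinAt) hbound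
    (Set.left_mem_Icc.2 zero_le_one) (Set.right_mem_Icc.2 zero_le_one)
  simp only [Real.norm_eq_abs, one_smul, neg_smul, zero_smul, neg_zero, add_zero, sub_zero,
    abs_one, mul_one] at this
  convert this using 2
  rw [sub_eq_add_neg c d]
  ring

/-- Error of the four-point second difference with nodes `±h/2`, `±3h/2`. -/
theorem abs_four_point_second_difference_sub_le {U V W : ℝ → ℝ}
    (hU : ∀ t, HasDerivAt U (V t) t) (hV : ∀ t, HasDerivAt V (W t) t) {h B : ℝ} (hh : 0 ≤ h)
    (hB : ∀ s ∈ Set.Icc 0 (3 * h / 2), |W s + W (-s) - 2 * W 0| ≤ B) :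
    |U (3 * h / 2) + U (-(3 * h / 2)) - U (h / 2) - U (-(h / 2)) - 2 * h ^ 2 * W 0|
      ≤ B * (3 * h / 2) * h := by
  have hB₀ : 0 ≤ B := (abs_nonneg _).trans (hB 0 ⟨le_rfl, by positivity⟩)
  have hV' : ∀ s, HasDerivAt (fun s => V s - V (-s) - 2 * s * W 0)
      (W s + W (-s) - 2 * W 0) s := by
    intro s
    have := ((hV s).sub ((hV (-s)).comp s (hasDerivAt_neg s))).sub
      (((hasDerivAt_id s).const_mul 2).mul_const (W 0))
    refine this.congr_deriv ?_
    simp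
  have hU' : ∀ s, HasDerivAt (fun s => U s + U (-s) - s ^ 2 * W 0)
      (V s - V (-s) - 2 * s * W 0) s := by
    intro s
    have := ((hU s).add ((hU (-s)).comp s (hasDerivAt_neg s))).sub
      ((hasDerivAt_pow 2 s).mul_const (W 0))
    refine this.congr_deriv ?_
    simp [sub_eq_add_neg]
  have hbound : ∀ s ∈ Set.Icc 0 (3 * h / 2),
      ‖V s - V (-s) - 2 * s * W 0‖ ≤ B * (3 * h / 2) := by
    intro s hs
    have := (convex_Icc 0 (3 * h / 2)).norm_image_sub_le_of_norm_hasDerivWithin_le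
      (fun t _ => (hV' t).hasDerivWithinAt) hB (Set.left_mem_Icc.2 (by positivity)) hs
    simp only [neg_zero, sub_self, mul_zero, zero_mul, sub_zero] at this
    refine this.trans ?_
    gcongr
    rw [Real.norm_eq_abs, abs_of_nonneg hs.1]
    exact hs.2
  have := (convex_Icc 0 (3 * h / 2)).norm_image_sub_le_of_norm_hasDerivWithin_le
    (fun t _ => (hU' t).hasDerivWithinAt) hbound
    (x := h / 2) (y := 3 * h / 2) ⟨by linarith, by linarith⟩ ⟨by linarith, le_rfl⟩
  rw [show 3 * h / 2 - h / 2 = h by ring, Real.norm_eq_abs, Real.norm_eq_abs,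
    abs_of_nonneg hh] at this
  convert this using 2
  ring

/-- Second-order consistency of the discrete second derivative along Y
for a `C⁴` function `u : ℝ³ → ℝ`, at the cell with lowest vertex `(x₀, y₀, z₀)`. -/
theorem discrete_second_derivative_Y_consistency
    (u : ℝ × ℝ × ℝ → ℝ) (hu : ContDiff ℝ 4 u) (x₀ y₀ z₀ : ℝ) :
    ∃ C : ℝ, 0 < C ∧ ∃ h₀ : ℝ, 0 < h₀ ∧ h₀ ≤ 1 ∧
      ∀ hx hy hz : ℝ, 0 < hx → 0 < hy → 0 < hz → hx ≤ h₀ → hy ≤ h₀ → hz ≤ h₀ →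
        |(1 / (8 * hy ^ 2)) *
            (∑ m ∈ Finset.range 4, etaCoeff m *
              ∑ n ∈ Finset.range 2, ∑ p ∈ Finset.range 2,
                u (x₀ + (n : ℝ) * hx, y₀ + ((m : ℝ) - 1) * hy, z₀ + (p : ℝ) * hz))
          - deriv (deriv (fun t => u (x₀ + hx / 2, t, z₀ + hz / 2))) (y₀ + hy / 2)|
          ≤ C * (max (max hx hy) hz) ^ 2 := by
  set e : ℝ × ℝ × ℝ := (0, 1, 0)
  set v : ℝ × ℝ × ℝ → ℝ := fun q => fderiv ℝ u q e
  set w : ℝ × ℝ × ℝ → ℝ := fun q => fderiv ℝ v q e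
  have hv : ContDiff ℝ 3 v := (hu.fderiv_right (m := 3) (by norm_num)).clm_apply contDiff_const
  have hw : ContDiff ℝ 2 w := (hv.fderiv_right (m := 2) (by norm_num)).clm_apply contDiff_const
  have hud : Differentiable ℝ u := hu.differentiable (by norm_num)
  have hvd : Differentiable ℝ v := hv.differentiable (by norm_num)
  have hwd : Differentiable ℝ w := hw.differentiable (by norm_num)
  have hline : ∀ a b t : ℝ, HasDerivAt (fun t : ℝ => ((a, t, b) : ℝ × ℝ × ℝ)) e t :=
    fun a b t => (hasDerivAt_const t a).prodMk ((hasDerivAt_id t).prodMk (hasDerivAt_const t b))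
  have hu' : ∀ a b t : ℝ, HasDerivAt (fun t => u (a, t, b)) (v (a, t, b)) t :=
    fun a b t => (hud _).hasFDerivAt.comp_hasDerivAt t (hline a b t)
  have hv' : ∀ a b t : ℝ, HasDerivAt (fun t => v (a, t, b)) (w (a, t, b)) t :=
    fun a b t => (hvd _).hasFDerivAt.comp_hasDerivAt t (hline a b t)
  obtain ⟨K, T, hT, hKT⟩ := ((hw.fderiv_right (m := 1) (by norm_num)).contDiffAt
    (x := (x₀, y₀, z₀))).exists_lipschitzOnWith
  obtain ⟨δ, hδ, hδT⟩ := Metric.mem_nhds_iff.1 hT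
  have hsecond := fun c d => abs_add_sub_two_mul_le_of_lipschitzOnWith_fderiv hwd
    (convex_ball (x₀, y₀, z₀) δ) (hKT.mono hδT) (c := c) (d := d)
  have hball : ∀ a b c : ℝ, |a - x₀| < δ → |b - y₀| < δ → |c - z₀| < δ →
      ((a, b, c) : ℝ × ℝ × ℝ) ∈ Metric.ball (x₀, y₀, z₀) δ := by
    intro a b c ha hb hc
    simp only [Metric.mem_ball, Prod.dist_eq, Real.dist_eq, max_lt_iff]
    exact ⟨ha, hb, hc⟩
  refine ⟨4 * K + 1, by positivity, min 1 (δ / 3), by positivity, min_le_left _ _, ?_⟩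
  intro hx hy hz hx0 hy0 hz0 hxl hyl hzl
  have hxδ := hxl.trans (min_le_right _ _)
  have hyδ := hyl.trans (min_le_right _ _)
  have hzδ := hzl.trans (min_le_right _ _)
  have hstencil : ∀ a b : ℝ, |a - x₀| < δ → |b - z₀| < δ →
      |u (a, y₀ + 2 * hy, b) + u (a, y₀ - hy, b) - u (a, y₀ + hy, b) - u (a, y₀, b)
        - 2 * hy ^ 2 * w (a, y₀ + hy / 2, b)| ≤ 27 / 4 * K * hy ^ 4 := by
    intro a b ha hb
    have := abs_four_point_second_difference_sub_le (h := hy)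
      (B := 2 * K * (3 * hy / 2) ^ 2)
      (fun t => (hu' a b ((y₀ + hy / 2) + t)).comp_const_add (y₀ + hy / 2) t)
      (fun t => (hv' a b ((y₀ + hy / 2) + t)).comp_const_add (y₀ + hy / 2) t) hy0.le ?_
    · convert this using 1
      · ring_nf
      · ring
    · intro s hs
      have hm := hsecond (a, y₀ + hy / 2, b) (0, s, 0)
        (by
          simp only [Prod.mk_add_mk, add_zero]
          exact hball _ _ _ ha (by rw [abs_lt]; constructor <;> linarith [hs.1, hs.2]) hb)
        (by
          simp only [Prod.mk_sub_mk, sub_zero]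
          exact hball _ _ _ ha (by rw [abs_lt]; constructor <;> linarith [hs.1, hs.2]) hb)
      simp only [Prod.mk_add_mk, Prod.mk_sub_mk, add_zero, sub_zero] at hm
      simp only [add_zero, ← sub_eq_add_neg]
      refine hm.trans ?_
      gcongr
      simpa [Prod.norm_def, abs_of_nonneg hs.1, hs.1] using hs.2
  set M := max (max hx hy) hz
  have hxM : hx ≤ M := (le_max_left _ _).trans (le_max_left _ _)
  have hyM : hy ≤ M := (le_max_right _ _).trans (le_max_left _ _)
  have hzM : hz ≤ M := le_max_right _ _
  have hcorner : ∀ r : ℝ, |r| = hz / 2 →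
      |w (x₀ + hx / 2 + hx / 2, y₀ + hy / 2, z₀ + hz / 2 + r)
        + w (x₀ + hx / 2 - hx / 2, y₀ + hy / 2, z₀ + hz / 2 - r)
        - 2 * w (x₀ + hx / 2, y₀ + hy / 2, z₀ + hz / 2)| ≤ 2 * K * (M / 2) ^ 2 := by
    intro r hr
    obtain ⟨hr₁, hr₂⟩ := abs_le.1 hr.le
    have hm := hsecond (x₀ + hx / 2, y₀ + hy / 2, z₀ + hz / 2) (hx / 2, 0, r)
      (by
        simp only [Prod.mk_add_mk, add_zero]
        apply hball <;> rw [abs_lt] <;> constructor <;> linarith)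
      (by
        simp only [Prod.mk_sub_mk, sub_zero]
        apply hball <;> rw [abs_lt] <;> constructor <;> linarith)
    simp only [Prod.mk_add_mk, Prod.mk_sub_mk, add_zero, sub_zero] at hm
    refine hm.trans ?_
    gcongr
    simp only [Prod.norm_def, Real.norm_eq_abs, hr, abs_zero, max_le_iff]
    rw [abs_of_pos (by positivity)]
    exact ⟨by linarith, by linarith, by linarith⟩
  have hderiv : deriv (deriv (fun t => u (x₀ + hx / 2, t, z₀ + hz / 2))) (y₀ + hy / 2)
      = w (x₀ + hx / 2, y₀ + hy / 2, z₀ + hz / 2) := by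
    rw [show deriv (fun t => u (x₀ + hx / 2, t, z₀ + hz / 2))
      = fun t => v (x₀ + hx / 2, t, z₀ + hz / 2) from funext fun t => (hu' _ _ t).deriv]
    exact (hv' _ _ _).deriv
  have d₁ := hcorner (hz / 2) (abs_of_pos (by positivity))
  have d₂ := hcorner (-(hz / 2)) (by rw [abs_neg, abs_of_pos (by positivity)])
  rw [show x₀ + hx / 2 + hx / 2 = x₀ + hx by ring, show x₀ + hx / 2 - hx / 2 = x₀ by ring,
    show z₀ + hz / 2 + hz / 2 = z₀ + hz by ring, show z₀ + hz / 2 - hz / 2 = z₀ by ring] at d₁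
  rw [show x₀ + hx / 2 + hx / 2 = x₀ + hx by ring, show x₀ + hx / 2 - hx / 2 = x₀ by ring,
    show z₀ + hz / 2 + -(hz / 2) = z₀ by ring,
    show z₀ + hz / 2 - -(hz / 2) = z₀ + hz by ring] at d₂
  have hax₀ : |x₀ - x₀| < δ := by simpa using hδ
  have hax₁ : |x₀ + hx - x₀| < δ := by
    rw [add_sub_cancel_left, abs_of_pos hx0]; linarith
  have haz₀ : |z₀ - z₀| < δ := by simpa using hδ
  have haz₁ : |z₀ + hz - z₀| < δ := by
    rw [add_sub_cancel_left, abs_of_pos hz0]; linarith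
  have s₁ := hstencil x₀ z₀ hax₀ haz₀
  have s₂ := hstencil x₀ (z₀ + hz) hax₀ haz₁
  have s₃ := hstencil (x₀ + hx) z₀ hax₁ haz₀
  have s₄ := hstencil (x₀ + hx) (z₀ + hz) hax₁ haz₁
  have hKy : (K : ℝ) * hy ^ 2 ≤ K * M ^ 2 := by gcongr
  have hKM : 0 ≤ (K : ℝ) * M ^ 2 := by positivity
  rw [hderiv]
  have hsum : (∑ m ∈ Finset.range 4, etaCoeff m *
      ∑ n ∈ Finset.range 2, ∑ p ∈ Finset.range 2,
        u (x₀ + (n : ℝ) * hx, y₀ + ((m : ℝ) - 1) * hy, z₀ + (p : ℝ) * hz)) =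
      (u (x₀, y₀ + 2 * hy, z₀) + u (x₀, y₀ - hy, z₀) - u (x₀, y₀ + hy, z₀) - u (x₀, y₀, z₀))
      + (u (x₀, y₀ + 2 * hy, z₀ + hz) + u (x₀, y₀ - hy, z₀ + hz)
        - u (x₀, y₀ + hy, z₀ + hz) - u (x₀, y₀, z₀ + hz))
      + (u (x₀ + hx, y₀ + 2 * hy, z₀) + u (x₀ + hx, y₀ - hy, z₀)
        - u (x₀ + hx, y₀ + hy, z₀) - u (x₀ + hx, y₀, z₀))
      + (u (x₀ + hx, y₀ + 2 * hy, z₀ + hz) + u (x₀ + hx, y₀ - hy, z₀ + hz)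
        - u (x₀ + hx, y₀ + hy, z₀ + hz) - u (x₀ + hx, y₀, z₀ + hz)) := by
    norm_num [Finset.sum_range_succ, etaCoeff, ← sub_eq_add_neg]
    ring
  rw [hsum]
  generalize u (x₀, y₀ + 2 * hy, z₀) + u (x₀, y₀ - hy, z₀) - u (x₀, y₀ + hy, z₀)
    - u (x₀, y₀, z₀) = S₁ at *
  generalize u (x₀, y₀ + 2 * hy, z₀ + hz) + u (x₀, y₀ - hy, z₀ + hz)
    - u (x₀, y₀ + hy, z₀ + hz) - u (x₀, y₀, z₀ + hz) = S₂ at *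
  generalize u (x₀ + hx, y₀ + 2 * hy, z₀) + u (x₀ + hx, y₀ - hy, z₀)
    - u (x₀ + hx, y₀ + hy, z₀) - u (x₀ + hx, y₀, z₀) = S₃ at *
  generalize u (x₀ + hx, y₀ + 2 * hy, z₀ + hz) + u (x₀ + hx, y₀ - hy, z₀ + hz)
    - u (x₀ + hx, y₀ + hy, z₀ + hz) - u (x₀ + hx, y₀, z₀ + hz) = S₄ at *
  have hscale : ∀ S A : ℝ, |S - 2 * hy ^ 2 * A| ≤ 27 / 4 * K * hy ^ 4 →
      |1 / (8 * hy ^ 2) * S - A / 4| ≤ 27 / 32 * (K * hy ^ 2) := by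
    intro S A hS
    have : 1 / (8 * hy ^ 2) * S - A / 4 = (S - 2 * hy ^ 2 * A) / (8 * hy ^ 2) := by
      field_simp
      ring
    rw [this, abs_div, abs_of_pos (a := 8 * hy ^ 2) (by positivity), div_le_iff₀ (by positivity)]
    linarith
  have t₁ := abs_le.1 (hscale _ _ s₁)
  have t₂ := abs_le.1 (hscale _ _ s₂)
  have t₃ := abs_le.1 (hscale _ _ s₃)
  have t₄ := abs_le.1 (hscale _ _ s₄)
  rw [abs_le] at d₁ d₂ ⊢
  have hM2 := sq_nonneg M
  constructor <;> linarith [t₁.1, t₁.2, t₂.1, t₂.2, t₃.1, t₃.2, t₄.1, t₄.2, d₁.1, d₁.2, d₂.1, d₂.2]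
end

section
/- Let u : ℝ³ → ℝ be four times continuously differentiable and fix a point (x₀,y₀,z₀) ∈ ℝ³. Then there exist constants C > 0 and h₀ ∈ (0,1] such that for all step sizes hx, hy, hz with 0 < hx,hy,hz ≤ h₀, the discrete second derivative along Z, Dzz u := (1/(8hz²)) ∑_{m=0}^{3} η_m ∑_{n∈{0,1}} ∑_{p∈{0,1}} u(x₀+n·hx, y₀+p·hy, z₀+(m−1)·hz), with weights η₀ = η₃ = 1 and η₁ = η₂ = −1, satisfies | Dzz u − ∂²u/∂z² (x₀+hx/2, y₀+hy/2, z₀+hz/2) | ≤ C · (max(hx,hy,hz))². -/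
open Set Metric

/-- A function vanishing to first order at `0` with second derivative bounded by `K` on `[0, s]`
is at most `K * s ^ 2` at `s`. -/
theorem abs_le_mul_sq_of_abs_second_deriv_le {F F' F'' : ℝ → ℝ} {K s : ℝ} (hs : 0 ≤ s)
    (hF : ∀ t, HasDerivAt F (F' t) t) (hF' : ∀ t, HasDerivAt F' (F'' t) t)
    (h0 : F 0 = 0) (h0' : F' 0 = 0) (hK : ∀ t ∈ Icc 0 s, |F'' t| ≤ K) :
    |F s| ≤ K * s ^ 2 := by
  have hK0 : 0 ≤ K := (abs_nonneg _).trans (hK 0 ⟨le_rfl, hs⟩)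
  have h1 : ∀ t ∈ Icc 0 s, |F' t| ≤ K * s := by
    intro t ht
    have h := (convex_Icc 0 s).norm_image_sub_le_of_norm_hasDerivWithin_le
      (fun x _ => (hF' x).hasDerivWithinAt) hK ⟨le_rfl, hs⟩ ht
    rw [h0', sub_zero, sub_zero, Real.norm_eq_abs, Real.norm_eq_abs, abs_of_nonneg ht.1] at h
    exact h.trans (mul_le_mul_of_nonneg_left ht.2 hK0)
  have h := (convex_Icc 0 s).norm_image_sub_le_of_norm_hasDerivWithin_le
    (fun x _ => (hF x).hasDerivWithinAt) h1 ⟨le_rfl, hs⟩ ⟨hs, le_rfl⟩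
  rw [h0, sub_zero, sub_zero, Real.norm_eq_abs, Real.norm_eq_abs, abs_of_nonneg hs] at h
  linarith

/-- The four-point stencil approximates `8 * s ^ 2 * m` when the second derivative is close
to `m`. -/
theorem abs_four_point_stencil_sub_le {A A' A'' : ℝ → ℝ} {K s m : ℝ} (hs : 0 ≤ s)
    (hA : ∀ t, HasDerivAt A (A' t) t) (hA' : ∀ t, HasDerivAt A' (A'' t) t)
    (hK : ∀ t, |t| ≤ 3 * s → |A'' t - m| ≤ K) :
    |A (3 * s) + A (-3 * s) - A s - A (-1 * s) - 8 * s ^ 2 * m| ≤ 20 * K * s ^ 2 := by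
  have scale {f f' : ℝ → ℝ} (hf : ∀ t, HasDerivAt f (f' t) t) (c t : ℝ) :
      HasDerivAt (fun t => f (c * t)) (c * f' (c * t)) t := by
    have h := (hf (c * t)).comp t ((hasDerivAt_id t).const_mul c)
    simpa [Function.comp_def, mul_comm] using h
  refine abs_le_mul_sq_of_abs_second_deriv_le
    (F := fun s => A (3 * s) + A (-3 * s) - A s - A (-1 * s) - 8 * s ^ 2 * m)
    (F' := fun t => 3 * A' (3 * t) + -3 * A' (-3 * t) - A' t - -1 * A' (-1 * t) - 16 * t * m)
    (F'' := fun t => 3 * (3 * A'' (3 * t)) + -3 * (-3 * A'' (-3 * t)) - A'' t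
      - -1 * (-1 * A'' (-1 * t)) - 16 * m)
    hs ?_ ?_ (by simp) (by simp) ?_
  · intro t
    have hq : HasDerivAt (fun t : ℝ => 8 * t ^ 2 * m) (16 * t * m) t := by
      refine (((hasDerivAt_pow 2 t).const_mul 8).mul_const m).congr_deriv ?_
      push_cast
      ring
    exact ((((scale hA 3 t).add (scale hA (-3) t)).sub (hA t)).sub (scale hA (-1) t)).sub hq
  · intro t
    have hq : HasDerivAt (fun t : ℝ => 16 * t * m) (16 * m) t := by
      simpa using ((hasDerivAt_id t).const_mul 16).mul_const m
    exact (((((scale hA' 3 t).const_mul 3).add ((scale hA' (-3) t).const_mul (-3))).sub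
      (hA' t)).sub ((scale hA' (-1) t).const_mul (-1))).sub hq
  · intro t ht
    have ht0 := ht.1
    have hts := ht.2
    have b1 := abs_le.1 (hK (3 * t) (by rw [abs_le]; constructor <;> linarith))
    have b2 := abs_le.1 (hK (-3 * t) (by rw [abs_le]; constructor <;> linarith))
    have b3 := abs_le.1 (hK t (by rw [abs_le]; constructor <;> linarith))
    have b4 := abs_le.1 (hK (-1 * t) (by rw [abs_le]; constructor <;> linarith))
    rw [abs_le]
    constructor <;> linarith [b1.1, b1.2, b2.1, b2.2, b3.1, b3.2, b4.1, b4.2]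

/-- The symmetric second difference of a `C²` function is locally `O(‖d‖²)`. -/
theorem exists_abs_symmetric_second_difference_le {E : Type*} [NormedAddCommGroup E]
    [NormedSpace ℝ E] {g : E → ℝ} (hg : ContDiff ℝ 2 g) (x : E) :
    ∃ K : ℝ, 0 ≤ K ∧ ∃ r : ℝ, 0 < r ∧ ∀ P d : E, ‖P - x‖ + ‖d‖ < r →
      |g (P + d) + g (P - d) - 2 * g P| ≤ K * ‖d‖ ^ 2 := by
  have hg' : ContDiff ℝ 1 (fderiv ℝ g) := hg.fderiv_right (by norm_num)
  obtain ⟨L, t, ht, hL⟩ := hg'.contDiffAt.exists_lipschitzOnWith (x := x)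
  obtain ⟨r, hr, hrt⟩ := Metric.mem_nhds_iff.1 ht
  refine ⟨2 * L, by positivity, r, hr, fun P d hPd => ?_⟩
  have hgd : Differentiable ℝ g := hg.differentiable (by norm_num)
  have hmem : ∀ c : ℝ, |c| ≤ 1 → P + c • d ∈ t := by
    intro c hc
    apply hrt
    rw [mem_ball, dist_eq_norm]
    calc ‖P + c • d - x‖ = ‖(P - x) + c • d‖ := by congr 1; abel
      _ ≤ ‖P - x‖ + |c| * ‖d‖ := (norm_add_le _ _).trans (by rw [norm_smul, Real.norm_eq_abs])
      _ ≤ ‖P - x‖ + ‖d‖ := by nlinarith [norm_nonneg d]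
      _ < r := hPd
  have hline (v : E) (c : ℝ) :
      HasDerivAt (fun c : ℝ => g (P + c • v)) (fderiv ℝ g (P + c • v) v) c := by
    have h1 : HasDerivAt (fun c : ℝ => P + c • v) v c := by
      simpa using ((hasDerivAt_id c).smul_const v).const_add P
    exact (hgd _).hasFDerivAt.comp_hasDerivAt c h1
  have hder (c : ℝ) := (hline d c).add (hline (-d) c)
  have hbound : ∀ c ∈ Icc (0 : ℝ) 1,
      ‖fderiv ℝ g (P + c • d) d + fderiv ℝ g (P + c • -d) (-d)‖ ≤ 2 * L * ‖d‖ ^ 2 := by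
    intro c hc
    have hc1 : |c| ≤ 1 := by rw [abs_of_nonneg hc.1]; exact hc.2
    have h := hL.norm_sub_le (hmem c hc1) (hmem (-c) (by rwa [abs_neg]))
    have hd : ‖P + c • d - (P + -c • d)‖ ≤ 2 * ‖d‖ := by
      have : P + c • d - (P + -c • d) = (2 * c) • d := by module
      rw [this, norm_smul, Real.norm_eq_abs, abs_mul, abs_two]
      nlinarith [norm_nonneg d]
    have he : fderiv ℝ g (P + c • d) d + fderiv ℝ g (P + c • -d) (-d)
        = (fderiv ℝ g (P + c • d) - fderiv ℝ g (P + -c • d)) d := by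
      simp [sub_eq_add_neg]
    rw [he]
    calc _ ≤ ‖fderiv ℝ g (P + c • d) - fderiv ℝ g (P + -c • d)‖ * ‖d‖ :=
          ContinuousLinearMap.le_opNorm _ _
      _ ≤ (L * (2 * ‖d‖)) * ‖d‖ := by gcongr; exact h.trans (by gcongr)
      _ = _ := by ring
  have h := (convex_Icc (0 : ℝ) 1).norm_image_sub_le_of_norm_hasDerivWithin_le
    (fun c _ => (hder c).hasDerivWithinAt) hbound ⟨le_rfl, zero_le_one⟩ ⟨zero_le_one, le_rfl⟩
  simp only [Pi.add_apply, one_smul, zero_smul, add_zero, sub_zero, norm_one, mul_one,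
    Real.norm_eq_abs, ← sub_eq_add_neg] at h
  rwa [two_mul (g P)]

/-- The partial derivative in the third coordinate. -/
theorem hasDerivAt_third_coordinate {u : ℝ × ℝ × ℝ → ℝ} (hu : Differentiable ℝ u) (x y z : ℝ) :
    HasDerivAt (fun t => u (x, y, t)) (fderiv ℝ u (x, y, z) (0, 0, 1)) z :=
  (hu _).hasFDerivAt.comp_hasDerivAt z
    ((hasDerivAt_const z x).prodMk ((hasDerivAt_const z y).prodMk (hasDerivAt_id z)))

/-- Second-order consistency of the discrete second derivative along Z
for a `C⁴` function `u : ℝ³ → ℝ`, at the cell with lowest vertex `(x₀, y₀, z₀)`. -/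
theorem discrete_second_derivative_Z_consistency
    (u : ℝ × ℝ × ℝ → ℝ) (hu : ContDiff ℝ 4 u) (x₀ y₀ z₀ : ℝ) :
    ∃ C : ℝ, 0 < C ∧ ∃ h₀ : ℝ, 0 < h₀ ∧ h₀ ≤ 1 ∧
      ∀ hx hy hz : ℝ, 0 < hx → 0 < hy → 0 < hz → hx ≤ h₀ → hy ≤ h₀ → hz ≤ h₀ →
        |(1 / (8 * hz ^ 2)) *
            (∑ m ∈ Finset.range 4, etaCoeff m *
              ∑ n ∈ Finset.range 2, ∑ p ∈ Finset.range 2,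
                u (x₀ + (n : ℝ) * hx, y₀ + (p : ℝ) * hy, z₀ + ((m : ℝ) - 1) * hz))
          - deriv (deriv (fun t => u (x₀ + hx / 2, y₀ + hy / 2, t))) (z₀ + hz / 2)|
          ≤ C * (max (max hx hy) hz) ^ 2 := by
  set u₁ : ℝ × ℝ × ℝ → ℝ := fun p => fderiv ℝ u p (0, 0, 1) with hu₁
  set g : ℝ × ℝ × ℝ → ℝ := fun p => fderiv ℝ u₁ p (0, 0, 1) with hg
  have cu₁ : ContDiff ℝ 3 u₁ := (hu.fderiv_right (by norm_num)).clm_apply contDiff_const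
  have cg : ContDiff ℝ 2 g := (cu₁.fderiv_right (by norm_num)).clm_apply contDiff_const
  have du := hasDerivAt_third_coordinate (hu.differentiable (by norm_num))
  have du₁ := hasDerivAt_third_coordinate (cu₁.differentiable (by norm_num))
  obtain ⟨K, hK0, r, hr, hK⟩ := exists_abs_symmetric_second_difference_le cg (x₀, y₀, z₀)
  refine ⟨5 * K + 1, by positivity, min 1 (r / 3), by positivity, min_le_left _ _, ?_⟩
  intro hx hy hz px py pz lx ly lz
  set H := max (max hx hy) hz with hH
  have hxH : hx ≤ H := (le_max_left _ _).trans (le_max_left _ _)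
  have hyH : hy ≤ H := (le_max_right _ _).trans (le_max_left _ _)
  have hzH : hz ≤ H := le_max_right _ _
  have hHr : H ≤ r / 3 := (max_le (max_le lx ly) lz).trans (min_le_right _ _)
  have hH0 : 0 < H := px.trans_le hxH
  set X := x₀ + hx / 2 with hX
  set Y := y₀ + hy / 2 with hY
  set Z := z₀ + hz / 2 with hZ
  have hderiv : deriv (deriv (fun t => u (X, Y, t))) Z = g (X, Y, Z) := by
    rw [show deriv (fun t => u (X, Y, t)) = fun t => u₁ (X, Y, t) from
      funext fun t => (du X Y t).deriv]
    exact (du₁ X Y Z).deriv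
  have hcenter : ‖(X, Y, Z) - (x₀, y₀, z₀)‖ ≤ H / 2 := by
    simp only [Prod.mk_sub_mk, Prod.norm_mk, Real.norm_eq_abs, hX, hY, hZ, add_sub_cancel_left]
    rw [abs_of_pos (by positivity), abs_of_pos (by positivity), abs_of_pos (by positivity)]
    exact max_le (by linarith) (max_le (by linarith) (by linarith))
  have pair (b : ℝ) (hb : |b| ≤ H / 2) :=
    abs_four_point_stencil_sub_le (s := hz / 2) (m := 2 * g (X, Y, Z)) (K := K * (3 * H / 2) ^ 2)
      (A := fun t => u (X + hx / 2, Y + b, Z + t) + u (X - hx / 2, Y - b, Z - t))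
      (A' := fun t => u₁ (X + hx / 2, Y + b, Z + t) - u₁ (X - hx / 2, Y - b, Z - t))
      (A'' := fun t => g (X + hx / 2, Y + b, Z + t) + g (X - hx / 2, Y - b, Z - t))
      (by positivity)
      (fun t => by
        have h1 := (du (X + hx / 2) (Y + b) (Z + t)).comp_const_add Z t
        have h2 := (du (X - hx / 2) (Y - b) (Z - t)).comp_const_sub Z t
        exact h1.add h2)
      (fun t => by
        have h1 := (du₁ (X + hx / 2) (Y + b) (Z + t)).comp_const_add Z t
        have h2 := (du₁ (X - hx / 2) (Y - b) (Z - t)).comp_const_sub Z t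
        exact (h1.sub h2).congr_deriv (sub_neg_eq_add _ _))
      (fun t ht => by
        have hd : ‖((hx / 2, b, t) : ℝ × ℝ × ℝ)‖ ≤ 3 * H / 2 := by
          simp only [Prod.norm_mk, Real.norm_eq_abs]
          rw [abs_of_pos (by positivity : 0 < hx / 2)]
          exact max_le (by linarith) (max_le (by linarith) (by linarith))
        refine (hK (X, Y, Z) (hx / 2, b, t) (by linarith)).trans ?_
        gcongr)
  have h1 := abs_le.1 (pair (hy / 2) (by rw [abs_of_pos (by positivity)]; linarith))
  have h2 := abs_le.1 (pair (-(hy / 2)) (by rw [abs_neg, abs_of_pos (by positivity)]; linarith))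
  have hpos : 0 < 8 * hz ^ 2 := by positivity
  rw [hderiv]
  have hsum : (∑ m ∈ Finset.range 4, etaCoeff m *
      ∑ n ∈ Finset.range 2, ∑ p ∈ Finset.range 2,
        u (x₀ + (n : ℝ) * hx, y₀ + (p : ℝ) * hy, z₀ + ((m : ℝ) - 1) * hz)) =
      8 * hz ^ 2 * (1 / (8 * hz ^ 2) * ∑ m ∈ Finset.range 4, etaCoeff m *
      ∑ n ∈ Finset.range 2, ∑ p ∈ Finset.range 2,
        u (x₀ + (n : ℝ) * hx, y₀ + (p : ℝ) * hy, z₀ + ((m : ℝ) - 1) * hz)) := by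
    rw [← mul_assoc, mul_one_div_cancel hpos.ne', one_mul]
  set D := 1 / (8 * hz ^ 2) * ∑ m ∈ Finset.range 4, etaCoeff m *
      ∑ n ∈ Finset.range 2, ∑ p ∈ Finset.range 2,
        u (x₀ + (n : ℝ) * hx, y₀ + (p : ℝ) * hy, z₀ + ((m : ℝ) - 1) * hz)
  have ex1 : X + hx / 2 = x₀ + hx := by rw [hX]; ring
  have ex0 : X - hx / 2 = x₀ := by rw [hX]; ring
  have ey1 : Y + hy / 2 = y₀ + hy := by rw [hY]; ring
  have ey0 : Y - hy / 2 = y₀ := by rw [hY]; ring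
  have ez3 : Z + 3 * (hz / 2) = z₀ + 2 * hz := by rw [hZ]; ring
  have ez3' : Z - 3 * (hz / 2) = z₀ - hz := by rw [hZ]; ring
  have ez1 : Z + hz / 2 = z₀ + hz := by rw [hZ]; ring
  have ez1' : Z - hz / 2 = z₀ := by rw [hZ]; ring
  simp only [neg_mul, one_mul, sub_neg_eq_add, ← sub_eq_add_neg, ex1, ex0, ey1, ey0, ez3, ez3',
    ez1, ez1'] at h1 h2
  have e2 : z₀ + (3 - 1) * hz = z₀ + 2 * hz := by ring
  have e1 : z₀ + (2 - 1) * hz = z₀ + hz := by ring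
  have e0 : z₀ + (0 - 1) * hz = z₀ - hz := by ring
  simp only [Finset.sum_range_succ, Finset.sum_range_zero, etaCoeff, Nat.cast_zero, Nat.cast_one,
    Nat.cast_ofNat, zero_add, zero_mul, add_zero, one_mul, sub_self, e2, e1, e0] at hsum
  norm_num at hsum
  have key : |8 * hz ^ 2 * (D - g (X, Y, Z))| ≤ 8 * hz ^ 2 * ((5 * K + 1) * H ^ 2) := by
    have hKH : 0 ≤ K * H ^ 2 * hz ^ 2 := by positivity
    have hHz : 0 ≤ H ^ 2 * hz ^ 2 := by positivity
    rw [mul_sub, ← hsum, abs_le]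
    constructor <;> linarith [h1.1, h1.2, h2.1, h2.2]
  rw [abs_mul, abs_of_pos hpos] at key
  exact le_of_mul_le_mul_left key hpos
end

section
/- Let u : ℝ³ → ℝ be four times continuously differentiable and fix a point (x₀,y₀,z₀) ∈ ℝ³. For step sizes hx,hy,hz > 0, define the discrete cell Laplacian at the cell with lowest vertex (a,b,c) as Δᶜu(a,b,c) := Dxx u(a,b,c) + Dyy u(a,b,c) + Dzz u(a,b,c), where Dxx, Dyy, Dzz are the discrete second derivatives along X, Y, Z at that cell, and define the discrete vertex Laplacian at (x₀,y₀,z₀) as the arithmetic average of the discrete cell Laplacians of the eight cells surrounding the vertex: Δⱽu(x₀,y₀,z₀) := (1/8) ∑_{m,n,p∈{0,1}} Δᶜu(x₀−hx+m·hx, y₀−hy+n·hy, z₀−hz+p·hz). Then there exist constants C > 0 and h₀ ∈ (0,1] such that for all 0 < hx,hy,hz ≤ h₀, | Δⱽu(x₀,y₀,z₀) − Δu(x₀,y₀,z₀) | ≤ C · (max(hx,hy,hz))², where Δu = ∂²u/∂x² + ∂²u/∂y² + ∂²u/∂z² is the continuous Laplacian. -/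
noncomputable section

/-- Discrete second derivative along X at the cell with lowest vertex `(a, b, c)`. -/
def Dxx (u : ℝ × ℝ × ℝ → ℝ) (hx hy hz a b c : ℝ) : ℝ :=
  (1 / (8 * hx ^ 2)) * ∑ m ∈ Finset.range 4, etaCoeff m *
    ∑ n ∈ Finset.range 2, ∑ p ∈ Finset.range 2,
      u (a + ((m : ℝ) - 1) * hx, b + (n : ℝ) * hy, c + (p : ℝ) * hz)

/-- Discrete second derivative along Y at the cell with lowest vertex `(a, b, c)`. -/
def Dyy (u : ℝ × ℝ × ℝ → ℝ) (hx hy hz a b c : ℝ) : ℝ :=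
  (1 / (8 * hy ^ 2)) * ∑ m ∈ Finset.range 4, etaCoeff m *
    ∑ n ∈ Finset.range 2, ∑ p ∈ Finset.range 2,
      u (a + (n : ℝ) * hx, b + ((m : ℝ) - 1) * hy, c + (p : ℝ) * hz)

/-- Discrete second derivative along Z at the cell with lowest vertex `(a, b, c)`. -/
def Dzz (u : ℝ × ℝ × ℝ → ℝ) (hx hy hz a b c : ℝ) : ℝ :=
  (1 / (8 * hz ^ 2)) * ∑ m ∈ Finset.range 4, etaCoeff m *
    ∑ n ∈ Finset.range 2, ∑ p ∈ Finset.range 2,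
      u (a + (n : ℝ) * hx, b + (p : ℝ) * hy, c + ((m : ℝ) - 1) * hz)

/-- Discrete cell Laplacian at the cell with lowest vertex `(a, b, c)`. -/
def cellLaplacian (u : ℝ × ℝ × ℝ → ℝ) (hx hy hz a b c : ℝ) : ℝ :=
  Dxx u hx hy hz a b c + Dyy u hx hy hz a b c + Dzz u hx hy hz a b c

/-- Discrete vertex Laplacian at the vertex `(x₀, y₀, z₀)`: the arithmetic average of
the discrete cell Laplacians of the eight cells surrounding the vertex. -/
def vertexLaplacian (u : ℝ × ℝ × ℝ → ℝ) (hx hy hz x₀ y₀ z₀ : ℝ) : ℝ :=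
  (1 / 8) * ∑ m ∈ Finset.range 2, ∑ n ∈ Finset.range 2, ∑ p ∈ Finset.range 2,
    cellLaplacian u hx hy hz
      (x₀ - hx + (m : ℝ) * hx) (y₀ - hy + (n : ℝ) * hy) (z₀ - hz + (p : ℝ) * hz)

open Set in
theorem abs_le_of_abs_deriv_le {f f' : ℝ → ℝ} {t K : ℝ} (ht : 0 ≤ t) (h0 : f 0 = 0)
    (hf : ∀ s, HasDerivAt f (f' s) s) (hK : ∀ s ∈ Icc 0 t, |f' s| ≤ K) : |f t| ≤ K * t := by
  have h := norm_image_sub_le_of_norm_deriv_le_segment' (f := f) (f' := f') (C := K)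
    (fun s _ => (hf s).hasDerivWithinAt) (fun s hs => hK s (Ico_subset_Icc_self hs)) t
    (right_mem_Icc.2 ht)
  simpa [h0] using h

theorem hasDerivAt_comp_neg_of_forall {g g' : ℝ → ℝ} (hg : ∀ s, HasDerivAt g (g' s) s) (s : ℝ) :
    HasDerivAt (fun s => g (-s)) (-g' (-s)) s :=
  ((hg (-s)).comp s (hasDerivAt_neg s)).congr_deriv (mul_neg_one _)

open Set in
theorem abs_second_difference_le {f f₁ f₂ : ℝ → ℝ} {t M : ℝ} (ht : 0 ≤ t)
    (hf : ∀ s, HasDerivAt f (f₁ s) s) (hf₁ : ∀ s, HasDerivAt f₁ (f₂ s) s)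
    (hM : ∀ s ∈ Icc (-t) t, |f₂ s| ≤ M) :
    |f t - 2 * f 0 + f (-t)| ≤ 2 * M * t ^ 2 := by
  have hM0 : 0 ≤ M := (abs_nonneg _).trans (hM 0 ⟨by linarith, ht⟩)
  have first (s : ℝ) (hs : s ∈ Icc 0 t) : |f₁ s - f₁ (-s)| ≤ 2 * M * t := by
    have h := abs_le_of_abs_deriv_le (f := fun s => f₁ s - f₁ (-s))
      (f' := fun s => f₂ s - -f₂ (-s)) (K := 2 * M) hs.1 (by simp)
      (fun r => (hf₁ r).sub (hasDerivAt_comp_neg_of_forall hf₁ r)) (fun r hr => by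
        have h₁ := abs_le.1 (hM r ⟨by linarith [hr.1], by linarith [hr.2, hs.2]⟩)
        have h₂ := abs_le.1 (hM (-r) ⟨by linarith [hr.2, hs.2], by linarith [hr.1]⟩)
        exact abs_le.2 ⟨by linarith, by linarith⟩)
    exact h.trans (mul_le_mul_of_nonneg_left hs.2 (by linarith))
  have h := abs_le_of_abs_deriv_le (f := fun s => f s - 2 * f 0 + f (-s))
    (f' := fun s => f₁ s + -f₁ (-s)) (K := 2 * M * t) ht (by simp; ring)
    (fun r => ((hf r).sub_const _).add (hasDerivAt_comp_neg_of_forall hf r))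
    (fun r hr => by simpa [sub_eq_add_neg] using first r hr)
  exact h.trans_eq (by ring)

open Set in
theorem abs_second_difference_sub_le {f f₁ f₂ f₃ f₄ : ℝ → ℝ} {t M : ℝ} (ht : 0 ≤ t)
    (hf : ∀ s, HasDerivAt f (f₁ s) s) (hf₁ : ∀ s, HasDerivAt f₁ (f₂ s) s)
    (hf₂ : ∀ s, HasDerivAt f₂ (f₃ s) s) (hf₃ : ∀ s, HasDerivAt f₃ (f₄ s) s)
    (hM : ∀ s ∈ Icc (-t) t, |f₄ s| ≤ M) :
    |f t - 2 * f 0 + f (-t) - t ^ 2 * f₂ 0| ≤ 2 * M * t ^ 4 := by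
  have hM0 : 0 ≤ M := (abs_nonneg _).trans (hM 0 ⟨by linarith, ht⟩)
  have second (s : ℝ) (hs : s ∈ Icc 0 t) :
      |f₂ s - 2 * f₂ 0 + f₂ (-s)| ≤ 2 * M * t ^ 2 := by
    refine (abs_second_difference_le hs.1 hf₂ hf₃ fun r hr =>
      hM r ⟨by linarith [hr.1, hs.2], hr.2.trans hs.2⟩).trans ?_
    have := hs.1
    have := hs.2
    gcongr
  have first (s : ℝ) (hs : s ∈ Icc 0 t) :
      |f₁ s - f₁ (-s) - 2 * f₂ 0 * s| ≤ 2 * M * t ^ 3 := by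
    have h := abs_le_of_abs_deriv_le (f := fun s => f₁ s - f₁ (-s) - 2 * f₂ 0 * s)
      (f' := fun s => f₂ s - -f₂ (-s) - 2 * f₂ 0 * 1) (K := 2 * M * t ^ 2) hs.1 (by simp)
      (fun r => ((hf₁ r).sub (hasDerivAt_comp_neg_of_forall hf₁ r)).sub
        ((hasDerivAt_id r).const_mul _))
      (fun r hr => by
        convert second r ⟨hr.1, hr.2.trans hs.2⟩ using 2
        ring)
    exact h.trans ((mul_le_mul_of_nonneg_left hs.2 (by positivity)).trans_eq (by ring))
  have h := abs_le_of_abs_deriv_le (f := fun s => f s - 2 * f 0 + f (-s) - f₂ 0 * s ^ 2)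
    (f' := fun s => f₁ s + -f₁ (-s) - f₂ 0 * (2 * s)) (K := 2 * M * t ^ 3) ht (by simp; ring)
    (fun r => (((hf r).sub_const _).add (hasDerivAt_comp_neg_of_forall hf r)).sub
      (((hasDerivAt_pow 2 r).congr_deriv (by simp)).const_mul _))
    (fun r hr => by
      convert first r hr using 2
      ring)
  rw [mul_comm (t ^ 2)]
  exact h.trans_eq (by ring)

section Directional

variable {E : Type*} [NormedAddCommGroup E] [NormedSpace ℝ E]

/-- The derivative of `w` in the constant direction `e`, as a function of the base point. -/
def dirDeriv (e : E) (w : E → ℝ) (p : E) : ℝ := fderiv ℝ w p e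

theorem ContDiff.dirDeriv {w : E → ℝ} {m n : ℕ∞} (hw : ContDiff ℝ n w) (e : E)
    (hmn : m + 1 ≤ n) : ContDiff ℝ m (dirDeriv e w) :=
  (hw.fderiv_right (by exact_mod_cast hmn)).clm_apply contDiff_const

theorem hasDerivAt_dirDeriv {w : E → ℝ} (hw : Differentiable ℝ w) (p e : E) (t : ℝ) :
    HasDerivAt (fun t : ℝ => w (p + t • e)) (dirDeriv e w (p + t • e)) t := by
  have h : HasDerivAt (fun t : ℝ => p + t • e) e t := by
    simpa using ((hasDerivAt_id t).smul_const e).const_add p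
  exact (hw _).hasFDerivAt.comp_hasDerivAt t h

theorem deriv_deriv_eq_dirDeriv {w : E → ℝ} (hw : ContDiff ℝ 4 w) (p e : E) (t : ℝ) :
    deriv (deriv fun t : ℝ => w (p + t • e)) t = dirDeriv e (dirDeriv e w) (p + t • e) := by
  have h₁ : ContDiff ℝ 3 (dirDeriv e w) := hw.dirDeriv (m := 3) (n := 4) e (by norm_num)
  have : (deriv fun t : ℝ => w (p + t • e)) = fun t => dirDeriv e w (p + t • e) :=
    funext fun t => (hasDerivAt_dirDeriv (hw.differentiable (by norm_num)) p e t).deriv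
  rw [this]
  exact (hasDerivAt_dirDeriv (h₁.differentiable (by norm_num)) p e t).deriv

open Set in
theorem exists_bound_box {w : E → ℝ} (hw : Continuous w) (p e₁ e₂ e₃ : E) :
    ∃ M, ∀ s ∈ Icc (-2 : ℝ) 2, ∀ t ∈ Icc (-2 : ℝ) 2, ∀ r ∈ Icc (-2 : ℝ) 2,
      |w (p + s • e₁ + t • e₂ + r • e₃)| ≤ M := by
  obtain ⟨M, hM⟩ := (isCompact_Icc.prod (isCompact_Icc.prod isCompact_Icc) :
      IsCompact (Icc (-2 : ℝ) 2 ×ˢ Icc (-2 : ℝ) 2 ×ˢ Icc (-2 : ℝ) 2)).exists_bound_of_continuousOn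
    (f := fun x => w (p + x.1 • e₁ + x.2.1 • e₂ + x.2.2 • e₃))
    (by fun_prop)
  exact ⟨M, fun s hs t ht r hr => hM (s, t, r) ⟨hs, ht, hr⟩⟩

/-- The second difference of `u` with step `2 * h` in direction `e` around the point `p`. -/
def secondDiff (u : E → ℝ) (e : E) (h : ℝ) (p : E) : ℝ :=
  u (p + (2 * h) • e) - 2 * u p + u (p + (-(2 * h)) • e)

/-- The trapezoidal average of `w` over the points `p - h • e`, `p`, `p + h • e`. -/
def trapAverage (e : E) (h : ℝ) (w : E → ℝ) (p : E) : ℝ :=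
  (w (p + h • e) + 2 * w p + w (p + (-h) • e)) / 4

open Set in
theorem exists_abs_trapAverage_secondDiff_sub_le {u : E → ℝ} (hu : ContDiff ℝ 4 u)
    (p e₁ e₂ e₃ : E) :
    ∃ C, 0 < C ∧ ∀ h₁ h₂ h₃ : ℝ, 0 < h₁ → 0 < h₂ → 0 < h₃ → h₁ ≤ 1 → h₂ ≤ 1 → h₃ ≤ 1 →
      |trapAverage e₃ h₃ (trapAverage e₂ h₂ (secondDiff u e₁ h₁)) p / (4 * h₁ ^ 2)
        - dirDeriv e₁ (dirDeriv e₁ u) p| ≤ C * (h₁ ^ 2 + h₂ ^ 2 + h₃ ^ 2) := by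
  have c₁ : ContDiff ℝ 3 (dirDeriv e₁ u) := hu.dirDeriv (m := 3) (n := 4) e₁ (by norm_num)
  set G := dirDeriv e₁ (dirDeriv e₁ u)
  have c₂ : ContDiff ℝ 2 G := c₁.dirDeriv (m := 2) (n := 3) e₁ (by norm_num)
  have c₃ (e : E) : ContDiff ℝ 1 (dirDeriv e G) :=
    c₂.dirDeriv (m := 1) (n := 2) e (by norm_num)
  have c₄ (e : E) : ContDiff ℝ 0 (dirDeriv e (dirDeriv e G)) :=
    (c₃ e).dirDeriv (m := 0) (n := 1) e (by norm_num)
  have d₀ := hu.differentiable (by norm_num)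
  have d₁ := c₁.differentiable (by norm_num)
  have d₂ := c₂.differentiable (by norm_num)
  have d₃ (e : E) := (c₃ e).differentiable (by norm_num)
  obtain ⟨M₁, hM₁⟩ := exists_bound_box (c₄ e₁).continuous p e₁ e₂ e₃
  obtain ⟨M₂, hM₂⟩ := exists_bound_box (c₄ e₂).continuous p e₁ e₂ e₃
  obtain ⟨M₃, hM₃⟩ := exists_bound_box (c₄ e₃).continuous p e₁ e₂ e₃
  obtain ⟨M, hM0, hMM₁, hMM₂, hMM₃⟩ : ∃ M, 0 < M ∧ M₁ ≤ M ∧ M₂ ≤ M ∧ M₃ ≤ M :=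
    ⟨|M₁| + |M₂| + |M₃| + 1, by positivity, by
      constructorm* _ ∧ _ <;>
      linarith [le_abs_self M₁, le_abs_self M₂, le_abs_self M₃, abs_nonneg M₁, abs_nonneg M₂,
        abs_nonneg M₃]⟩
  refine ⟨8 * M, by positivity, fun h₁ h₂ h₃ p₁ p₂ p₃ l₁ l₂ l₃ => ?_⟩
  have along₁ (t r : ℝ) (ht : t ∈ Icc (-2 : ℝ) 2) (hr : r ∈ Icc (-2 : ℝ) 2) :
      |secondDiff u e₁ h₁ (p + r • e₃ + t • e₂) - (2 * h₁) ^ 2 * G (p + r • e₃ + t • e₂)|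
        ≤ 2 * M * (2 * h₁) ^ 4 := by
    have h := abs_second_difference_sub_le (t := 2 * h₁) (M := M) (by positivity)
      (hasDerivAt_dirDeriv d₀ (p + r • e₃ + t • e₂) e₁)
      (hasDerivAt_dirDeriv d₁ (p + r • e₃ + t • e₂) e₁)
      (hasDerivAt_dirDeriv d₂ (p + r • e₃ + t • e₂) e₁)
      (hasDerivAt_dirDeriv (d₃ e₁) (p + r • e₃ + t • e₂) e₁) (fun s hs => by
        refine le_trans ?_ hMM₁
        rw [show p + r • e₃ + t • e₂ + s • e₁ = p + s • e₁ + t • e₂ + r • e₃ by abel]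
        exact hM₁ s ⟨by linarith [hs.1], by linarith [hs.2]⟩ t ht r hr)
    simpa [secondDiff] using h
  have along₂ (r : ℝ) (hr : r ∈ Icc (-2 : ℝ) 2) :
      |G (p + r • e₃ + h₂ • e₂) - 2 * G (p + r • e₃) + G (p + r • e₃ + (-h₂) • e₂)|
        ≤ 2 * M * h₂ ^ 2 := by
    have h := abs_second_difference_le (t := h₂) (M := M) p₂.le
      (hasDerivAt_dirDeriv d₂ (p + r • e₃) e₂)
      (hasDerivAt_dirDeriv (d₃ e₂) (p + r • e₃) e₂) (fun t ht => by
        refine le_trans ?_ hMM₂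
        rw [show p + r • e₃ + t • e₂ = p + (0 : ℝ) • e₁ + t • e₂ + r • e₃ by
          rw [zero_smul]; abel]
        exact hM₂ 0 (by simp) t ⟨by linarith [ht.1], by linarith [ht.2]⟩ r hr)
    simpa using h
  have along₃ : |G (p + h₃ • e₃) - 2 * G p + G (p + (-h₃) • e₃)| ≤ 2 * M * h₃ ^ 2 := by
    have h := abs_second_difference_le (t := h₃) (M := M) p₃.le
      (hasDerivAt_dirDeriv d₂ p e₃)
      (hasDerivAt_dirDeriv (d₃ e₃) p e₃) (fun r hr => by
        refine le_trans ?_ hMM₃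
        simpa using hM₃ 0 (by simp) 0 (by simp) r ⟨by linarith [hr.1], by linarith [hr.2]⟩)
    simpa using h
  have trap₂ (r : ℝ) (hr : r ∈ Icc (-2 : ℝ) 2) :
      |trapAverage e₂ h₂ (secondDiff u e₁ h₁) (p + r • e₃) - 4 * h₁ ^ 2 * G (p + r • e₃)|
        ≤ 4 * h₁ ^ 2 * (8 * M * h₁ ^ 2 + M * h₂ ^ 2) := by
    have a₁ := abs_le.1 (along₁ h₂ r ⟨by linarith, by linarith⟩ hr)
    have a₂ := abs_le.1 (along₁ (-h₂) r ⟨by linarith, by linarith⟩ hr)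
    have a₃ := along₁ 0 r (by simp) hr
    simp only [zero_smul, add_zero] at a₃
    replace a₃ := abs_le.1 a₃
    have b := abs_le.1 (along₂ r hr)
    have b₁ := mul_le_mul_of_nonneg_left b.1 (sq_nonneg h₁)
    have b₂ := mul_le_mul_of_nonneg_left b.2 (sq_nonneg h₁)
    have : 0 ≤ M * (h₁ ^ 2 * h₂ ^ 2) := by positivity
    unfold trapAverage
    exact abs_le.2 ⟨by linarith, by linarith⟩
  have trap₃ : |trapAverage e₃ h₃ (trapAverage e₂ h₂ (secondDiff u e₁ h₁)) p - 4 * h₁ ^ 2 * G p|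
      ≤ 4 * h₁ ^ 2 * (8 * M * (h₁ ^ 2 + h₂ ^ 2 + h₃ ^ 2)) := by
    have a₁ := abs_le.1 (trap₂ h₃ ⟨by linarith, by linarith⟩)
    have a₂ := abs_le.1 (trap₂ (-h₃) ⟨by linarith, by linarith⟩)
    have a₃ := trap₂ 0 (by simp)
    simp only [zero_smul, add_zero] at a₃
    replace a₃ := abs_le.1 a₃
    have b := abs_le.1 along₃
    have b₁ := mul_le_mul_of_nonneg_left b.1 (sq_nonneg h₁)
    have b₂ := mul_le_mul_of_nonneg_left b.2 (sq_nonneg h₁)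
    have : 0 ≤ M * (h₁ ^ 2 * h₂ ^ 2) := by positivity
    have : 0 ≤ M * (h₁ ^ 2 * h₃ ^ 2) := by positivity
    rw [trapAverage]
    exact abs_le.2 ⟨by linarith, by linarith⟩
  have pos : 0 < 4 * h₁ ^ 2 := by positivity
  rw [div_sub' pos.ne', abs_div, abs_of_pos pos, div_le_iff₀' pos]
  exact trap₃

end Directional

theorem vertexLaplacian_eq (u : ℝ × ℝ × ℝ → ℝ) (hx hy hz x₀ y₀ z₀ : ℝ) :
    vertexLaplacian u hx hy hz x₀ y₀ z₀ =
      trapAverage (0, 0, 1) hz (trapAverage (0, 1, 0) hy (secondDiff u (1, 0, 0) hx))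
          (x₀, y₀, z₀) / (4 * hx ^ 2)
        + trapAverage (0, 0, 1) hz (trapAverage (1, 0, 0) hx (secondDiff u (0, 1, 0) hy))
          (x₀, y₀, z₀) / (4 * hy ^ 2)
        + trapAverage (0, 1, 0) hy (trapAverage (1, 0, 0) hx (secondDiff u (0, 0, 1) hz))
          (x₀, y₀, z₀) / (4 * hz ^ 2) := by
  simp only [vertexLaplacian, cellLaplacian, Dxx, Dyy, Dzz, etaCoeff, trapAverage, secondDiff,
    Finset.sum_range_succ, Finset.sum_range_zero, Prod.mk_add_mk, Prod.smul_mk, smul_eq_mul]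
  norm_num
  ring_nf

/-- Second-order consistency of the discrete vertex Laplacian for a `C⁴` function. -/
theorem discrete_vertex_laplacian_consistency
    (u : ℝ × ℝ × ℝ → ℝ) (hu : ContDiff ℝ 4 u) (x₀ y₀ z₀ : ℝ) :
    ∃ C : ℝ, 0 < C ∧ ∃ h₀ : ℝ, 0 < h₀ ∧ h₀ ≤ 1 ∧
      ∀ hx hy hz : ℝ, 0 < hx → 0 < hy → 0 < hz → hx ≤ h₀ → hy ≤ h₀ → hz ≤ h₀ →
        |vertexLaplacian u hx hy hz x₀ y₀ z₀
          - (deriv (deriv (fun t => u (t, y₀, z₀))) x₀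
            + deriv (deriv (fun t => u (x₀, t, z₀))) y₀
            + deriv (deriv (fun t => u (x₀, y₀, t))) z₀)|
          ≤ C * (max (max hx hy) hz) ^ 2 := by
  obtain ⟨A, hA, hxb⟩ := exists_abs_trapAverage_secondDiff_sub_le hu (x₀, y₀, z₀)
    (1, 0, 0) (0, 1, 0) (0, 0, 1)
  obtain ⟨B, hB, hyb⟩ := exists_abs_trapAverage_secondDiff_sub_le hu (x₀, y₀, z₀)
    (0, 1, 0) (1, 0, 0) (0, 0, 1)
  obtain ⟨D, hD, hzb⟩ := exists_abs_trapAverage_secondDiff_sub_le hu (x₀, y₀, z₀)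
    (0, 0, 1) (1, 0, 0) (0, 1, 0)
  have ex := deriv_deriv_eq_dirDeriv hu (0, y₀, z₀) (1, 0, 0) x₀
  have ey := deriv_deriv_eq_dirDeriv hu (x₀, 0, z₀) (0, 1, 0) y₀
  have ez := deriv_deriv_eq_dirDeriv hu (x₀, y₀, 0) (0, 0, 1) z₀
  simp only [Prod.mk_add_mk, Prod.smul_mk, smul_eq_mul, mul_zero, mul_one, zero_add,
    add_zero] at ex ey ez
  refine ⟨3 * (A + B + D), by positivity, 1, one_pos, le_rfl,
    fun hx hy hz px py pz lx ly lz => ?_⟩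
  set m := max (max hx hy) hz
  have hxm : hx ^ 2 ≤ m ^ 2 :=
    pow_le_pow_left₀ px.le ((le_max_left hx hy).trans (le_max_left _ _)) 2
  have hym : hy ^ 2 ≤ m ^ 2 :=
    pow_le_pow_left₀ py.le ((le_max_right hx hy).trans (le_max_left _ _)) 2
  have hzm : hz ^ 2 ≤ m ^ 2 := pow_le_pow_left₀ pz.le (le_max_right _ _) 2
  have bx := abs_le.1 ((hxb hx hy hz px py pz lx ly lz).trans
    (mul_le_mul_of_nonneg_left (by linarith : _ ≤ 3 * m ^ 2) hA.le))
  have bw := abs_le.1 ((hyb hy hx hz py px pz ly lx lz).trans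
    (mul_le_mul_of_nonneg_left (by linarith : _ ≤ 3 * m ^ 2) hB.le))
  have bz := abs_le.1 ((hzb hz hx hy pz px py lz lx ly).trans
    (mul_le_mul_of_nonneg_left (by linarith : _ ≤ 3 * m ^ 2) hD.le))
  rw [vertexLaplacian_eq, ex, ey, ez]
  exact abs_le.2 ⟨by linarith, by linarith⟩

end
end

section
/- Let r₁, r₂ be positive integers, let U₁ : ℤ → (1×r₁ real matrices), U₂ : ℤ → (r₁×r₂ real matrices), U₃ : ℤ → (r₂×1 real matrices), and define u : ℤ³ → ℝ by u(i,j,k) := the unique entry of U₁(i)·U₂(j)·U₃(k). Fix hy > 0 and define Dyy u(i,j,k) := (1/(8hy²)) ∑_{m=0}^{3} η_m ∑_{n∈{0,1}} ∑_{p∈{0,1}} u(i+n, j−1+m, k+p), with η₀ = η₃ = 1 and η₁ = η₂ = −1. Then for all integers i, j, k, Dyy u(i,j,k) equals the unique entry of the matrix product ((U₁(i)+U₁(i+1))/2) · ( (1/(2hy)) · ( (U₂(j+2)−U₂(j+1))/hy − (U₂(j)−U₂(j−1))/hy ) ) · ((U₃(k)+U₃(k+1))/2). -/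
/-- Discrete second derivative along Y of a grid function `u : ℤ³ → ℝ` with step `hy`. -/
noncomputable def DyyGrid (u : ℤ → ℤ → ℤ → ℝ) (hy : ℝ) (i j k : ℤ) : ℝ :=
  (1 / (8 * hy ^ 2)) * ∑ m ∈ Finset.range 4, etaCoeff m *
    ∑ n ∈ Finset.range 2, ∑ p ∈ Finset.range 2,
      u (i + (n : ℤ)) (j - 1 + (m : ℤ)) (k + (p : ℤ))

/-- Core-wise form of the discrete second derivative along Y of a rank-separated
(tensor-train) grid function. -/
theorem tt_discrete_second_derivative_Y
    (r₁ r₂ : ℕ) (hr₁ : 0 < r₁) (hr₂ : 0 < r₂)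
    (U₁ : ℤ → Matrix (Fin 1) (Fin r₁) ℝ)
    (U₂ : ℤ → Matrix (Fin r₁) (Fin r₂) ℝ)
    (U₃ : ℤ → Matrix (Fin r₂) (Fin 1) ℝ)
    (u : ℤ → ℤ → ℤ → ℝ)
    (hu : ∀ i j k : ℤ, u i j k = (U₁ i * U₂ j * U₃ k) 0 0)
    (hy : ℝ) (hhy : 0 < hy) :
    ∀ i j k : ℤ,
      DyyGrid u hy i j k =
        ((((1 : ℝ) / 2) • (U₁ i + U₁ (i + 1))) *
          ((1 / (2 * hy)) •
            ((1 / hy) • (U₂ (j + 2) - U₂ (j + 1)) - (1 / hy) • (U₂ j - U₂ (j - 1)))) *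
          (((1 : ℝ) / 2) • (U₃ k + U₃ (k + 1)))) 0 0 := by
  intro i j k
  have h₁ : j - 1 + 1 = j := by ring
  have h₂ : j - 1 + 2 = j + 1 := by ring
  have h₃ : j - 1 + 3 = j + 2 := by ring
  simp only [DyyGrid, etaCoeff, Finset.sum_range_succ, Finset.sum_range_zero, hu]
  norm_num [h₁, h₂, h₃, Matrix.add_mul, Matrix.mul_add, Matrix.sub_mul, Matrix.mul_sub]
  field_simp
  ring
end
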